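/- arXiv:2510.05443 — 2 statements merged into one kernel-verified Lean document; each statement's English description precedes it below -/
import Mathlib

section
/- Let d be a positive integer, U a set of control values, and N a positive integer (the prediction horizon). Let F, F̂ : ℝ^d × U → ℝ^d with F Lipschitz in its first argument with constant L_x ≥ 0 (uniformly in u), and ‖F(x,u) − F̂(x,u)‖ ≤ ε for all (x,u), where ε ≥ 0. Let (u_i)_{i=0}^{N−1} be controls and let (x_i)_{i=0}^{N}, (x̂_i)_{i=0}^{N} satisfy x_{i+1} = F(x_i, u_i), x̂_{i+1} = F̂(x̂_i, u_i), and x̂_0 = x_0. Let ℓ : ℝ^d × U → ℝ be Lipschitz in its first argument with constant L_ℓ ≥ 0 (uniformly in u), and let l_f : ℝ^d → ℝ be Lipschitz with constant L_{l_f} ≥ 0. Then | Σ_{i=0}^{N−1} ℓ(x_i, u_i) + l_f(x_N) − Σ_{i=0}^{N−1} ℓ(x̂_i, u_i) − l_f(x̂_N) | ≤ Γ_N · ε, where Γ_N = L_ℓ · Σ_{i=0}^{N−1} ( Σ_{j=0}^{i−1} L_x^j ) + L_{l_f} · Σ_{j=0}^{N−1} L_x^j. -/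
/-- Predicted vs actual finite-horizon cost difference in MPC: with a one-step
model error `ε`, Lipschitz dynamics (constant `L_x`), Lipschitz stage cost
(constant `L_ℓ`) and terminal cost (constant `L_{l_f}`), the true and predicted
finite-horizon costs under the same control sequence differ by at most
`Γ_N · ε`, where
`Γ_N = L_ℓ * ∑_{i<N} (∑_{j<i} L_x^j) + L_{l_f} * ∑_{j<N} L_x^j`. -/
theorem mpc_horizon_cost_difference
    {d : ℕ} (hd : 0 < d) {U : Type*} (N : ℕ) (hN : 0 < N)
    (F Fhat : EuclideanSpace ℝ (Fin d) × U → EuclideanSpace ℝ (Fin d))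
    (Lx : ℝ) (hLx : 0 ≤ Lx)
    (hF_lip : ∀ (u : U) (x₁ x₂ : EuclideanSpace ℝ (Fin d)),
      ‖F (x₁, u) - F (x₂, u)‖ ≤ Lx * ‖x₁ - x₂‖)
    (ε : ℝ) (hε : 0 ≤ ε)
    (happrox : ∀ (x : EuclideanSpace ℝ (Fin d)) (u : U), ‖F (x, u) - Fhat (x, u)‖ ≤ ε)
    (u : ℕ → U) (x xhat : ℕ → EuclideanSpace ℝ (Fin d))
    (hx : ∀ i < N, x (i + 1) = F (x i, u i))
    (hxhat : ∀ i < N, xhat (i + 1) = Fhat (xhat i, u i))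
    (h0 : xhat 0 = x 0)
    (ℓ : EuclideanSpace ℝ (Fin d) × U → ℝ) (Lℓ : ℝ) (hLℓ : 0 ≤ Lℓ)
    (hℓ_lip : ∀ (u : U) (x₁ x₂ : EuclideanSpace ℝ (Fin d)),
      |ℓ (x₁, u) - ℓ (x₂, u)| ≤ Lℓ * ‖x₁ - x₂‖)
    (lf : EuclideanSpace ℝ (Fin d) → ℝ) (Llf : ℝ) (hLlf : 0 ≤ Llf)
    (hlf_lip : ∀ x₁ x₂ : EuclideanSpace ℝ (Fin d),
      |lf x₁ - lf x₂| ≤ Llf * ‖x₁ - x₂‖) :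
    |(∑ i ∈ Finset.range N, ℓ (x i, u i)) + lf (x N)
      - (∑ i ∈ Finset.range N, ℓ (xhat i, u i)) - lf (xhat N)|
      ≤ (Lℓ * ∑ i ∈ Finset.range N, (∑ j ∈ Finset.range i, Lx ^ j)
          + Llf * ∑ j ∈ Finset.range N, Lx ^ j) * ε := by
  have key : ∀ i, i ≤ N → ‖x i - xhat i‖ ≤ (∑ j ∈ Finset.range i, Lx ^ j) * ε := by
    intro i
    induction i with
    | zero => intro _; simp [h0]
    | succ k ih =>
      intro hk
      have h1 := ih (by omega)
      rw [hx k (by omega), hxhat k (by omega), geom_sum_succ]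
      have h2 := norm_sub_le_norm_sub_add_norm_sub (F (x k, u k)) (F (xhat k, u k))
        (Fhat (xhat k, u k))
      have h3 := hF_lip (u k) (x k) (xhat k)
      have h4 := happrox (xhat k) (u k)
      have h5 := mul_le_mul_of_nonneg_left h1 hLx
      linarith
  have hs : |∑ i ∈ Finset.range N, (ℓ (x i, u i) - ℓ (xhat i, u i))|
      ≤ ∑ i ∈ Finset.range N, Lℓ * ((∑ j ∈ Finset.range i, Lx ^ j) * ε) := by
    refine (Finset.abs_sum_le_sum_abs _ _).trans (Finset.sum_le_sum fun i hi => ?_)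
    exact (hℓ_lip _ _ _).trans
      (mul_le_mul_of_nonneg_left (key i (Finset.mem_range.1 hi).le) hLℓ)
  have hf := (hlf_lip (x N) (xhat N)).trans (mul_le_mul_of_nonneg_left (key N le_rfl) hLlf)
  rw [← Finset.mul_sum, ← Finset.sum_mul, Finset.sum_sub_distrib] at hs
  have ht := abs_add_le ((∑ i ∈ Finset.range N, ℓ (x i, u i))
    - ∑ i ∈ Finset.range N, ℓ (xhat i, u i)) (lf (x N) - lf (xhat N))
  calc _ = _ := by congr 1; ring
    _ ≤ _ := ht
    _ ≤ _ := add_le_add hs hf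
    _ = _ := by ring
end

section
/- Let α : ℝ → ℝ satisfy: α(0) = 0; α is strictly increasing on [0,∞); and α(b) − α(a) ≤ b − a whenever 0 ≤ a ≤ b (i.e., s ↦ s − α(s) is nondecreasing on [0,∞)). Let c ≥ 0 and suppose c = α(r) for some r ≥ 0. Let (v_k) be a sequence of nonnegative real numbers satisfying v_{k+1} ≤ v_k − α(v_k) + c for all k ≥ 0. Then the sequence is uniformly ultimately bounded: limsup_{k→∞} v_k ≤ r = α^{−1}(c). -/
/-- Uniform ultimate boundedness: let `α` be a comparison function with `α 0 = 0`,
strictly increasing on `[0,∞)`, and such that `s ↦ s - α s` is nondecreasing on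
`[0,∞)` (i.e. `α b - α a ≤ b - a` for `0 ≤ a ≤ b`). If `c ≥ 0` with `c = α r`
for some `r ≥ 0`, and `(v_k)` is a nonnegative sequence with
`v_{k+1} ≤ v_k - α (v_k) + c`, then `limsup v_k ≤ r`. -/
theorem uniform_ultimate_boundedness
    (α : ℝ → ℝ) (hα0 : α 0 = 0)
    (hα_mono : StrictMonoOn α (Set.Ici (0 : ℝ)))
    (hα_slope : ∀ a b : ℝ, 0 ≤ a → a ≤ b → α b - α a ≤ b - a)
    (c r : ℝ) (hc : 0 ≤ c) (hr : 0 ≤ r) (hcr : c = α r)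
    (v : ℕ → ℝ) (hv_nonneg : ∀ k, 0 ≤ v k)
    (hrec : ∀ k, v (k + 1) ≤ v k - α (v k) + c) :
    Filter.limsup v Filter.atTop ≤ r := by
  refine le_of_forall_pos_le_add fun ε hε => ?_
  have hR : 0 ≤ r + ε := by linarith
  have hδ : α r < α (r + ε) := hα_mono hr hR (by linarith)
  have hinv : ∀ k, v k ≤ r + ε → v (k + 1) ≤ r + ε := by
    intro k hk
    have h1 := hα_slope (v k) (r + ε) (hv_nonneg k) hk
    have h2 := hrec k
    linarith
  have hex : ∃ k, v k ≤ r + ε := by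
    by_contra hcon
    have hgt : ∀ k, r + ε < v k := fun k => by
      by_contra h
      exact hcon ⟨k, not_lt.mp h⟩
    have hdec : ∀ k : ℕ, v k ≤ v 0 - k * (α (r + ε) - α r) := by
      intro k
      induction k with
      | zero => simp
      | succ n ih =>
        have h1 := hrec n
        have h2 : α (r + ε) < α (v n) := hα_mono hR (hv_nonneg n) (hgt n)
        push_cast
        linarith
    obtain ⟨n, hn⟩ := exists_nat_gt (v 0 / (α (r + ε) - α r))
    rw [div_lt_iff₀ (by linarith)] at hn
    linarith [hdec n, hv_nonneg n]
  obtain ⟨K, hK⟩ := hex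
  have hall : ∀ k, K ≤ k → v k ≤ r + ε := by
    intro k hk
    induction k, hk using Nat.le_induction with
    | base => exact hK
    | succ n _ ih => exact hinv n ih
  refine Filter.limsup_le_of_le ?_ (Filter.eventually_atTop.mpr ⟨K, hall⟩)
  exact Filter.IsCoboundedUnder.of_frequently_ge
    (Filter.Frequently.of_forall (f := Filter.atTop) hv_nonneg)
end
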